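/- arXiv:math/0305123 — 2 statements merged into one kernel-verified Lean document; each statement's English description precedes it below -/
import Mathlib

section
/- For every real q with 0 < q < 1, every integer n ≥ 1, every multi-index m = (m_1,…,m_n) ∈ ℤ_{≥0}^n with |m| = m_1+…+m_n, and every t ∈ (0,1): (tq²;q²)_n · Σ_{k_1 ≥ k_2 ≥ … ≥ k_n ≥ 0} q^{2(k_2 m_1 + k_3 m_2 + … + k_n m_{n-1})} · [∏_{j=1}^{n-1} (q^{2(k_j−k_{j+1})+2};q²)_{m_j}] · (q^{2k_n+2};q²)_{m_n} · t^{k_1} q^{2k_1} q^{2(k_2+…+k_n)} = ∏_{i=1}^{n} (q²;q²)_{m_i} / (t q^{2n+2};q²)_{|m|}, the series on the left being absolutely convergent. (With t = q^{2α} this is the squared norm ‖z^m‖²_{α,q} of the monomial z^m in the q-weighted Bergman space, Proposition 3.1.) -/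
/-- The q²-shifted factorial `(a; q²)_m = ∏_{j=0}^{m-1} (1 − a q^{2j})`. -/
noncomputable def qpochR (q a : ℝ) (m : ℕ) : ℝ :=
  ∏ j ∈ Finset.range m, (1 - a * q ^ (2 * j))

/-- The general term of the series computing `‖z^m‖²_{α,q}`, indexed by decreasing chains
`k_1 ≥ k_2 ≥ … ≥ k_n ≥ 0` (with the convention `k_{n+1} = 0`):
`t^{k_1} q^{2(k_1+…+k_n)} q^{2(k_2 m_1 + … + k_n m_{n-1})}
  ∏_{j=1}^{n-1} (q^{2(k_j−k_{j+1})+2};q²)_{m_j} · (q^{2k_n+2};q²)_{m_n}`. -/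
noncomputable def chainTerm (q t : ℝ) (n : ℕ) (m : Fin n → ℕ)
    (k : {k : Fin n → ℕ // ∀ i j : Fin n, i ≤ j → k j ≤ k i}) : ℝ :=
  let kk : ℕ → ℕ := fun i => if h : i < n then k.1 ⟨i, h⟩ else 0
  t ^ kk 0 * q ^ (2 * ∑ j : Fin n, k.1 j) *
    q ^ (2 * ∑ j : Fin n, kk ((j : ℕ) + 1) * m j) *
    ∏ j : Fin n, qpochR q (q ^ (2 * (k.1 j - kk ((j : ℕ) + 1)) + 2)) (m j)

theorem qpochR_succ (q a : ℝ) (m : ℕ) :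
    qpochR q a (m + 1) = qpochR q a m * (1 - a * q ^ (2 * m)) :=
  Finset.prod_range_succ _ _

theorem qpochR_add (q a : ℝ) (m n : ℕ) :
    qpochR q a (m + n) = qpochR q a m * qpochR q (a * q ^ (2 * m)) n := by
  unfold qpochR
  rw [Finset.prod_range_add]
  congr 1
  exact Finset.prod_congr rfl fun j _ => by ring

theorem qpochR_pos {q a : ℝ} (hq0 : 0 < q) (hq1 : q < 1) (ha0 : 0 ≤ a) (ha1 : a < 1) (m : ℕ) :
    0 < qpochR q a m :=
  Finset.prod_pos fun j _ => by
    have h : q ^ (2 * j) ≤ 1 := pow_le_one₀ hq0.le hq1.le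
    have := mul_le_of_le_one_right ha0 h
    linarith

/-- The `q`-binomial series `∑ x^l (q^{2l+2}; q²)_m = (q²; q²)_m / (x; q²)_{m+1}`. -/
theorem hasSum_pow_mul_qpochR {q : ℝ} (hq0 : 0 < q) (hq1 : q < 1) (m : ℕ) {x : ℝ}
    (hx0 : 0 ≤ x) (hx1 : x < 1) :
    HasSum (fun l : ℕ => x ^ l * qpochR q (q ^ (2 * l + 2)) m)
      (qpochR q (q ^ 2) m / qpochR q x (m + 1)) := by
  induction m generalizing x with
  | zero => simpa [qpochR] using hasSum_geometric_of_lt_one hx0 hx1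
  | succ m ih =>
    have hp : q ^ 2 < 1 := pow_lt_one₀ hq0.le hq1 two_ne_zero
    have hxq0 : 0 ≤ x * q ^ 2 := by positivity
    have hxq1 : x * q ^ 2 < 1 := (mul_le_of_le_one_right hx0 hp.le).trans_lt hx1
    convert (ih hx0 hx1).sub ((ih hxq0 hxq1).mul_left (q ^ (2 * m + 2))) using 1
    · rfl
    · funext l
      rw [qpochR_succ]
      ring
    · have h1 := qpochR_pos hq0 hq1 hx0 hx1 (m + 2)
      have h2 := qpochR_pos hq0 hq1 hx0 hx1 (m + 1)
      have h3 := qpochR_pos hq0 hq1 hxq0 hxq1 (m + 1)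
      have e1 : qpochR q x (m + 2) = qpochR q x (m + 1) * (1 - x * q ^ (2 * (m + 1))) :=
        qpochR_succ ..
      have e2 : qpochR q x (m + 2) = (1 - x) * qpochR q (x * q ^ 2) (m + 1) := by
        rw [show m + 2 = 1 + (m + 1) by ring, qpochR_add]
        simp [qpochR]
      rw [qpochR_succ q (q ^ 2) m, show m + 1 + 1 = m + 2 from rfl,
        div_eq_iff h1.ne', sub_mul, mul_assoc, div_mul_eq_mul_div, div_mul_eq_mul_div]
      nth_rewrite 1 [e1]
      rw [e2]
      generalize qpochR q (x * q ^ 2) (m + 1) = Y at h3 ⊢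
      field_simp
      ring

/-- The entries of a decreasing chain, extended by zero. -/
def chainExt {n : ℕ} (k : Fin n → ℕ) (i : ℕ) : ℕ :=
  if h : i < n then k ⟨i, h⟩ else 0

theorem chainExt_cons_succ {n : ℕ} (a : ℕ) (k : Fin n → ℕ) (i : ℕ) :
    chainExt (Fin.cons a k : Fin (n + 1) → ℕ) (i + 1) = chainExt k i := by
  unfold chainExt
  by_cases h : i < n
  · rw [dif_pos h, dif_pos (Nat.succ_lt_succ h)]
    exact Fin.cons_succ (α := fun _ => ℕ) a k ⟨i, h⟩
  · rw [dif_neg h, dif_neg (by omega)]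

theorem chainExt_cons_zero {n : ℕ} (a : ℕ) (k : Fin n → ℕ) :
    chainExt (Fin.cons a k : Fin (n + 1) → ℕ) 0 = a := by
  simp [chainExt]

theorem le_chainExt_zero {n : ℕ} {k : Fin n → ℕ} (hk : ∀ i j : Fin n, i ≤ j → k j ≤ k i)
    (j : Fin n) : k j ≤ chainExt k 0 := by
  have h : 0 < n := j.pos
  rw [chainExt, dif_pos h]
  exact hk _ _ (Fin.mk_le_of_le_val (Nat.zero_le _))

/-- A decreasing chain of length `n + 1` is determined by its first gap and its tail. -/
def chainConsEquiv (n : ℕ) :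
    (ℕ × {k : Fin n → ℕ // ∀ i j : Fin n, i ≤ j → k j ≤ k i}) ≃
      {k : Fin (n + 1) → ℕ // ∀ i j : Fin (n + 1), i ≤ j → k j ≤ k i} where
  toFun p := ⟨Fin.cons (p.1 + chainExt p.2.1 0) p.2.1, fun i j hij => by
    induction j using Fin.cases with
    | zero => rw [Fin.le_zero_iff.mp hij]
    | succ j =>
      induction i using Fin.cases with
      | zero =>
        simp only [Fin.cons_zero, Fin.cons_succ]
        exact (le_chainExt_zero p.2.2 j).trans (Nat.le_add_left _ _)
      | succ i =>
        simp only [Fin.cons_succ]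
        exact p.2.2 i j (Fin.succ_le_succ_iff.mp hij)⟩
  invFun k := (k.1 0 - chainExt (Fin.tail k.1) 0,
    ⟨Fin.tail k.1, fun i j hij => k.2 _ _ (Fin.succ_le_succ_iff.mpr hij)⟩)
  left_inv p := by simp
  right_inv k := by
    apply Subtype.ext
    have h : chainExt (Fin.tail k.1) 0 ≤ k.1 0 := by
      unfold chainExt
      split
      · exact k.2 _ _ (Fin.zero_le _)
      · exact Nat.zero_le _
    simp only [Nat.sub_add_cancel h]
    exact Fin.cons_self_tail k.1

theorem chainTerm_eq (q t : ℝ) (n : ℕ) (m : Fin n → ℕ)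
    (k : {k : Fin n → ℕ // ∀ i j : Fin n, i ≤ j → k j ≤ k i}) :
    chainTerm q t n m k = t ^ chainExt k.1 0 * q ^ (2 * ∑ j : Fin n, k.1 j) *
      q ^ (2 * ∑ j : Fin n, chainExt k.1 ((j : ℕ) + 1) * m j) *
      ∏ j : Fin n, qpochR q (q ^ (2 * (k.1 j - chainExt k.1 ((j : ℕ) + 1)) + 2)) (m j) :=
  rfl

theorem chainTerm_chainConsEquiv (q t : ℝ) (n : ℕ) (m : Fin (n + 1) → ℕ)
    (p : ℕ × {k : Fin n → ℕ // ∀ i j : Fin n, i ≤ j → k j ≤ k i}) :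
    chainTerm q t (n + 1) m (chainConsEquiv n p) =
      ((t * q ^ 2) ^ p.1 * qpochR q (q ^ (2 * p.1 + 2)) (m 0)) *
        chainTerm q (t * q ^ (2 * (m 0 + 1))) n (Fin.tail m) p.2 := by
  obtain ⟨l, k, hk⟩ := p
  simp only [chainTerm_eq, chainConsEquiv, Equiv.coe_fn_mk, Fin.sum_univ_succ,
    Fin.prod_univ_succ, Fin.cons_zero, Fin.cons_succ, Fin.val_zero, Fin.val_succ,
    chainExt_cons_succ, chainExt_cons_zero, Nat.add_sub_cancel, Fin.tail]
  ring

theorem chainTerm_nonneg {q t : ℝ} (hq0 : 0 < q) (hq1 : q < 1) (ht0 : 0 ≤ t) {n : ℕ}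
    (m : Fin n → ℕ) (k : {k : Fin n → ℕ // ∀ i j : Fin n, i ≤ j → k j ≤ k i}) :
    0 ≤ chainTerm q t n m k := by
  rw [chainTerm_eq]
  have : 0 ≤ ∏ j : Fin n,
      qpochR q (q ^ (2 * (k.1 j - chainExt k.1 ((j : ℕ) + 1)) + 2)) (m j) :=
    Finset.prod_nonneg fun j _ =>
      (qpochR_pos hq0 hq1 (by positivity) (pow_lt_one₀ hq0.le hq1 (by omega)) _).le
  positivity

theorem hasSum_chainTerm {q : ℝ} (hq0 : 0 < q) (hq1 : q < 1) (n : ℕ) (m : Fin n → ℕ) {t : ℝ}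
    (ht0 : 0 ≤ t) (ht1 : t < 1) :
    HasSum (chainTerm q t n m)
      ((∏ i : Fin n, qpochR q (q ^ 2) (m i)) / qpochR q (t * q ^ 2) (n + ∑ i, m i)) := by
  induction n generalizing t with
  | zero =>
    have : Unique {k : Fin 0 → ℕ // ∀ i j : Fin 0, i ≤ j → k j ≤ k i} :=
      ⟨⟨⟨Fin.elim0, fun i => i.elim0⟩⟩, fun k => Subtype.ext (Subsingleton.elim _ _)⟩
    convert hasSum_unique (chainTerm q t 0 m) using 1
    simp [chainTerm_eq, chainExt, qpochR]
  | succ n ih =>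
    have h1 : t * q ^ 2 < 1 :=
      (mul_le_of_le_one_right ht0 (pow_le_one₀ hq0.le hq1.le)).trans_lt ht1
    have h2 : t * q ^ (2 * (m 0 + 1)) < 1 :=
      (mul_le_of_le_one_right ht0 (pow_le_one₀ hq0.le hq1.le)).trans_lt ht1
    have hA := hasSum_pow_mul_qpochR hq0 hq1 (m 0) (x := t * q ^ 2) (by positivity) h1
    have hB := ih (Fin.tail m) (t := t * q ^ (2 * (m 0 + 1))) (by positivity) h2
    have hAB := hA.summable.mul_of_nonneg hB.summable
      (fun l => mul_nonneg (by positivity)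
        (qpochR_pos hq0 hq1 (by positivity) (pow_lt_one₀ hq0.le hq1 (by omega)) _).le)
      (chainTerm_nonneg hq0 hq1 (by positivity) _)
    rw [← (chainConsEquiv n).hasSum_iff]
    convert hA.mul hB hAB using 1
    · rfl
    · exact funext fun p => chainTerm_chainConsEquiv q t n m p
    · rw [Fin.prod_univ_succ, Fin.sum_univ_succ,
        show n + 1 + (m 0 + ∑ i : Fin n, m i.succ) = (m 0 + 1) + (n + ∑ i : Fin n, m i.succ) by
          ring, qpochR_add, mul_div_mul_comm, mul_right_comm t]
      rfl

/-- Proposition 3.1: the squared norm of the monomial `z^m` in the `q`-weighted Bergman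
space: `(tq²;q²)_n Σ_{k_1≥…≥k_n≥0} (…) = ∏_i (q²;q²)_{m_i} / (tq^{2n+2};q²)_{|m|}`,
the series being absolutely convergent. -/
theorem statement2 (q : ℝ) (hq0 : 0 < q) (hq1 : q < 1) (n : ℕ) (hn : 1 ≤ n)
    (m : Fin n → ℕ) (t : ℝ) (ht0 : 0 < t) (ht1 : t < 1) :
    Summable (chainTerm q t n m) ∧
    qpochR q (t * q ^ 2) n * ∑' k, chainTerm q t n m k =
      (∏ i : Fin n, qpochR q (q ^ 2) (m i)) /
        qpochR q (t * q ^ (2 * n + 2)) (∑ i, m i) := by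
  have h := hasSum_chainTerm hq0 hq1 n m ht0.le ht1
  have h1 : t * q ^ 2 < 1 :=
    (mul_le_of_le_one_right ht0.le (pow_le_one₀ hq0.le hq1.le)).trans_lt ht1
  have h2 := qpochR_pos hq0 hq1 (by positivity) h1 n
  refine ⟨h.summable, ?_⟩
  rw [h.tsum_eq, qpochR_add, mul_assoc t, ← pow_add, add_comm 2 (2 * n), ← mul_div_assoc,
    mul_div_mul_left _ _ h2.ne']
end

section
/- For every integer n ≥ 1, every ρ ∈ ℝ, and every m ∈ ℤ_{≥0}: q²/(1−q²)² · [ (1 − q^{2m}) φ_ρ(q^{2m−2}) − (1 + q^{−2n} − 2q^{2m}) φ_ρ(q^{2m}) + (q^{−2n} − q^{2m}) φ_ρ(q^{2m+2}) ] = λ(ρ) · φ_ρ(q^{2m}), where the first term is absent for m = 0 (its coefficient vanishes). In other words, φ_ρ is an eigenfunction of the radial q-Laplace–Beltrami operator Δ with eigenvalue λ(ρ). -/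
/-- The q²-shifted factorial `(a; q²)_m = ∏_{j=0}^{m-1} (1 − a q^{2j})`. -/
noncomputable def qpochC (q : ℝ) (a : ℂ) (m : ℕ) : ℂ :=
  ∏ j ∈ Finset.range m, (1 - a * (q : ℂ) ^ (2 * j))

/-- `q^z = e^{z·ln q}` for complex `z` (so `q^{x±iρ} = q^x e^{±iρ ln q}`). -/
noncomputable def qcpow (q : ℝ) (z : ℂ) : ℂ := Complex.exp (z * Real.log q)

/-- The q-spherical function
`φ_ρ(q^{2m}) = Σ_{l=0}^m (q^{-2m};q²)_l (q^{n+iρ};q²)_l (q^{n-iρ};q²)_l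
  / ((q^{2n};q²)_l (q²;q²)_l) · q^{2l}`. -/
noncomputable def sphPhi (q : ℝ) (n : ℕ) (ρ : ℝ) (m : ℕ) : ℂ :=
  ∑ l ∈ Finset.range (m + 1),
    qpochC q (((q : ℂ) ^ (2 * m))⁻¹) l *
      qpochC q (qcpow q ((n : ℂ) + ρ * Complex.I)) l *
      qpochC q (qcpow q ((n : ℂ) - ρ * Complex.I)) l /
      (qpochC q ((q : ℂ) ^ (2 * n)) l * qpochC q ((q : ℂ) ^ 2) l) * (q : ℂ) ^ (2 * l)

/-- `λ(ρ) = −q^{2−2n} (1 − q^{n+iρ})(1 − q^{n−iρ}) / (1 − q²)²`. -/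
noncomputable def sphLam (q : ℝ) (n : ℕ) (ρ : ℝ) : ℂ :=
  -(q : ℂ) ^ ((2 : ℤ) - 2 * n) * (1 - qcpow q ((n : ℂ) + ρ * Complex.I)) *
    (1 - qcpow q ((n : ℂ) - ρ * Complex.I)) / (1 - (q : ℂ) ^ 2) ^ 2

theorem qpochC_succ (q : ℝ) (a : ℂ) (l : ℕ) :
    qpochC q a (l + 1) = qpochC q a l * (1 - a * (q : ℂ) ^ (2 * l)) :=
  Finset.prod_range_succ _ _

theorem qpochC_succ_left (q : ℝ) (a : ℂ) (l : ℕ) :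
    qpochC q a (l + 1) = (1 - a) * qpochC q (a * (q : ℂ) ^ 2) l := by
  unfold qpochC
  rw [Finset.prod_range_succ', mul_comm]
  simp only [mul_zero, pow_zero, mul_one, mul_add, pow_add]
  congr 1
  exact Finset.prod_congr rfl fun j _ => by ring

/-- The coefficient of `(q^{-2m}; q²)_l` in the basic hypergeometric sum `φ_ρ(q^{2m})`, with
`A = q^{n+iρ}`, `B = q^{n-iρ}` and `N = q^{2n}`. -/
noncomputable def sphCoeff (q : ℝ) (A B N : ℂ) (l : ℕ) : ℂ :=
  qpochC q A l * qpochC q B l / (qpochC q N l * qpochC q ((q : ℂ) ^ 2) l) * (q : ℂ) ^ (2 * l)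

theorem sphCoeff_succ (q : ℝ) (A B N : ℂ) (l : ℕ) :
    sphCoeff q A B N (l + 1) = sphCoeff q A B N l *
      ((1 - A * (q : ℂ) ^ (2 * l)) * (1 - B * (q : ℂ) ^ (2 * l)) * (q : ℂ) ^ 2 /
        ((1 - N * (q : ℂ) ^ (2 * l)) * (1 - (q : ℂ) ^ 2 * (q : ℂ) ^ (2 * l)))) := by
  unfold sphCoeff
  simp only [qpochC_succ, mul_add, pow_add, div_eq_mul_inv, mul_inv]
  ring

theorem one_sub_pow_ne_zero {q : ℝ} (hq0 : 0 < q) (hq1 : q < 1) {k : ℕ} (hk : k ≠ 0) :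
    1 - (q : ℂ) ^ k ≠ 0 := by
  have h : q ^ k < 1 := pow_lt_one₀ hq0.le hq1 hk
  rw [sub_ne_zero]
  exact_mod_cast h.ne'

/-- The truncated hypergeometric series satisfies the eigenvalue equation of the radial
`q`-Laplacian up to an explicit boundary term. -/
theorem sum_sphCoeff_mul_laplacian {q : ℝ} (hq0 : 0 < q) (hq1 : q < 1) {n : ℕ} (hn : 1 ≤ n)
    {A B x : ℂ} (hAB : A * B = (q : ℂ) ^ (2 * n)) (hx : x ≠ 0) (K : ℕ) :
    ∑ l ∈ Finset.range (K + 1), sphCoeff q A B ((q : ℂ) ^ (2 * n)) l *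
      ((1 - x) * qpochC q (x⁻¹ * (q : ℂ) ^ 2) l -
        (1 + ((q : ℂ) ^ (2 * n))⁻¹ - 2 * x) * qpochC q x⁻¹ l +
        (((q : ℂ) ^ (2 * n))⁻¹ - x) * qpochC q (x⁻¹ / (q : ℂ) ^ 2) l +
        ((q : ℂ) ^ (2 * n))⁻¹ * (1 - A) * (1 - B) * qpochC q x⁻¹ l) =
    sphCoeff q A B ((q : ℂ) ^ (2 * n)) K *
      ((1 - A * (q : ℂ) ^ (2 * K)) * (1 - B * (q : ℂ) ^ (2 * K)) /
        ((q : ℂ) ^ (2 * n) * (q : ℂ) ^ (2 * K))) * qpochC q x⁻¹ K := by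
  have hq : (q : ℂ) ≠ 0 := by exact_mod_cast hq0.ne'
  induction K with
  | zero =>
    simp only [zero_add, Finset.sum_range_one, qpochC, sphCoeff, Finset.range_zero,
      Finset.prod_empty, mul_zero, pow_zero]
    ring
  | succ l ih =>
    rw [Finset.sum_range_succ, ih, sphCoeff_succ]
    have hN : 1 - (q : ℂ) ^ (2 * n) * (q : ℂ) ^ (2 * l) ≠ 0 := by
      rw [← pow_add]
      exact one_sub_pow_ne_zero hq0 hq1 (by omega)
    have hp : 1 - (q : ℂ) ^ 2 * (q : ℂ) ^ (2 * l) ≠ 0 := by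
      rw [← pow_add]
      exact one_sub_pow_ne_zero hq0 hq1 (by omega)
    have hup : (1 - x) * qpochC q (x⁻¹ * (q : ℂ) ^ 2) (l + 1) =
        -x * (qpochC q x⁻¹ l * (1 - x⁻¹ * (q : ℂ) ^ (2 * l)) *
          (1 - x⁻¹ * ((q : ℂ) ^ 2 * (q : ℂ) ^ (2 * l)))) := by
      have h : qpochC q x⁻¹ (l + 1 + 1) = _ := qpochC_succ_left q x⁻¹ (l + 1)
      rw [qpochC_succ, qpochC_succ, mul_add 2 l 1, pow_add] at h
      have h' : 1 - x = -x * (1 - x⁻¹) := by field_simp; ring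
      rw [h', mul_assoc, ← h]
      ring
    have hdown : qpochC q (x⁻¹ / (q : ℂ) ^ 2) (l + 1) =
        (1 - x⁻¹ / (q : ℂ) ^ 2) * qpochC q x⁻¹ l := by
      rw [qpochC_succ_left, div_mul_cancel₀ _ (pow_ne_zero 2 hq)]
    rw [hup, hdown, qpochC_succ, mul_add 2 l 1, pow_add (q : ℂ) (2 * l)]
    have hN0 : (q : ℂ) ^ (2 * n) ≠ 0 := pow_ne_zero _ hq
    have ht0 : (q : ℂ) ^ (2 * l) ≠ 0 := pow_ne_zero _ hq
    have hp0 : (q : ℂ) ^ 2 ≠ 0 := pow_ne_zero _ hq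
    rw [mul_one]
    rw [← hAB] at hN hN0 ⊢
    have hA0 := left_ne_zero_of_mul hN0
    have hB0 := right_ne_zero_of_mul hN0
    generalize sphCoeff q A B (A * B) l = c
    generalize qpochC q x⁻¹ l = e
    generalize (q : ℂ) ^ (2 * l) = t at *
    generalize (q : ℂ) ^ 2 = p at *
    generalize hD : 1 - A * B * t = D at *
    generalize hE : 1 - p * t = E at *
    field_simp
    rw [← hD, ← hE]
    ring

theorem qpochC_inv_pow_eq_zero {q : ℝ} (hq0 : 0 < q) {m l : ℕ} (h : m < l) :
    qpochC q ((q : ℂ) ^ (2 * m))⁻¹ l = 0 := by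
  have hq : (q : ℂ) ^ (2 * m) ≠ 0 := pow_ne_zero _ (by exact_mod_cast hq0.ne')
  exact Finset.prod_eq_zero (Finset.mem_range.2 h) (by rw [inv_mul_cancel₀ hq, sub_self])

theorem sphPhi_eq_sum {q : ℝ} (hq0 : 0 < q) (n : ℕ) (ρ : ℝ) {m M : ℕ} (h : m < M) :
    sphPhi q n ρ m = ∑ l ∈ Finset.range M,
      sphCoeff q (qcpow q ((n : ℂ) + ρ * Complex.I)) (qcpow q ((n : ℂ) - ρ * Complex.I))
        ((q : ℂ) ^ (2 * n)) l * qpochC q ((q : ℂ) ^ (2 * m))⁻¹ l := by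
  rw [← Finset.sum_subset (Finset.range_subset_range.2 (Nat.succ_le_of_lt h))]
  · exact Finset.sum_congr rfl fun l _ => by unfold sphCoeff; ring
  · intro l _ hl
    rw [qpochC_inv_pow_eq_zero hq0 (by simpa using hl), mul_zero]

theorem qcpow_add_mul_qcpow_sub {q : ℝ} (hq0 : 0 < q) (n : ℕ) (z : ℂ) :
    qcpow q (n + z) * qcpow q (n - z) = (q : ℂ) ^ (2 * n) := by
  unfold qcpow
  rw [← Complex.exp_add, ← add_mul, add_add_sub_cancel, ← two_mul,
    show (2 * (n : ℂ)) * (Real.log q : ℂ) = ((2 * n : ℕ) : ℂ) * (Real.log q : ℂ) by push_cast; rfl,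
    Complex.exp_nat_mul, ← Complex.ofReal_exp, Real.exp_log hq0]

/-- `φ_ρ` is an eigenfunction of the radial q-Laplace–Beltrami operator with
eigenvalue `λ(ρ)`. -/
theorem statement4 (q : ℝ) (hq0 : 0 < q) (hq1 : q < 1) (n : ℕ) (hn : 1 ≤ n)
    (ρ : ℝ) (m : ℕ) :
    (q : ℂ) ^ 2 / (1 - (q : ℂ) ^ 2) ^ 2 *
      ((1 - (q : ℂ) ^ (2 * m)) * (if m = 0 then 0 else sphPhi q n ρ (m - 1)) -
        (1 + ((q : ℂ) ^ (2 * n))⁻¹ - 2 * (q : ℂ) ^ (2 * m)) * sphPhi q n ρ m +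
        (((q : ℂ) ^ (2 * n))⁻¹ - (q : ℂ) ^ (2 * m)) * sphPhi q n ρ (m + 1)) =
    sphLam q n ρ * sphPhi q n ρ m := by
  have hq : (q : ℂ) ≠ 0 := by exact_mod_cast hq0.ne'
  have hAB := qcpow_add_mul_qcpow_sub hq0 n (ρ * Complex.I)
  have key := sum_sphCoeff_mul_laplacian hq0 hq1 hn hAB (pow_ne_zero (2 * m) hq) (m + 1)
  rw [qpochC_inv_pow_eq_zero hq0 m.lt_succ_self, mul_zero] at key
  have hprev : (1 - (q : ℂ) ^ (2 * m)) * (if m = 0 then 0 else sphPhi q n ρ (m - 1)) =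
      (1 - (q : ℂ) ^ (2 * m)) * ∑ l ∈ Finset.range (m + 1 + 1),
        sphCoeff q (qcpow q ((n : ℂ) + ρ * Complex.I)) (qcpow q ((n : ℂ) - ρ * Complex.I))
          ((q : ℂ) ^ (2 * n)) l * qpochC q (((q : ℂ) ^ (2 * m))⁻¹ * (q : ℂ) ^ 2) l := by
    cases m with
    | zero => simp
    | succ k =>
      rw [if_neg k.succ_ne_zero, Nat.add_sub_cancel,
        sphPhi_eq_sum hq0 n ρ (show k < k + 1 + 1 + 1 by omega),
        show ((q : ℂ) ^ (2 * (k + 1)))⁻¹ * (q : ℂ) ^ 2 = ((q : ℂ) ^ (2 * k))⁻¹ by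
          rw [mul_add, pow_add]; field_simp]
  have hnext : ((q : ℂ) ^ (2 * (m + 1)))⁻¹ = ((q : ℂ) ^ (2 * m))⁻¹ / (q : ℂ) ^ 2 := by
    rw [mul_add, pow_add]; field_simp
  have hlam : sphLam q n ρ = (q : ℂ) ^ 2 / (1 - (q : ℂ) ^ 2) ^ 2 *
      -(((q : ℂ) ^ (2 * n))⁻¹ * (1 - qcpow q ((n : ℂ) + ρ * Complex.I)) *
        (1 - qcpow q ((n : ℂ) - ρ * Complex.I))) := by
    have hpow : (q : ℂ) ^ ((2 : ℤ) - 2 * n) = (q : ℂ) ^ 2 * ((q : ℂ) ^ (2 * n))⁻¹ := by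
      rw [zpow_sub₀ hq, div_eq_mul_inv]
      norm_cast
    unfold sphLam
    rw [hpow]
    ring
  rw [hprev, hlam, mul_assoc _ (-_), sphPhi_eq_sum hq0 n ρ (show m < m + 1 + 1 by omega),
    sphPhi_eq_sum hq0 n ρ (Nat.lt_succ_self (m + 1)), hnext]
  congr 1
  rw [← sub_eq_zero, ← key]
  simp only [Finset.mul_sum, ← Finset.sum_sub_distrib, ← Finset.sum_add_distrib]
  exact Finset.sum_congr rfl fun l _ => by ring
end
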